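/- arXiv:2405.05326 — 2 statements merged into one kernel-verified Lean document; each statement's English description precedes it below -/
import Mathlib

section
/- Let ρ_{AB} be a bipartite state and τ := (id_A ⊗ E)(ρ) for a quantum channel (completely positive trace-preserving map) E : B → B'. Then E_sq(A;B')_τ ≤ E_puff(A;B)_ρ is implied whenever E_sq(A;B')_τ ≤ E_sq(A;B)_ρ ≤ E_puff(A;B)_ρ; in particular, if a state τ_{RQ''} satisfies E_sq(R;Q'')_τ > H(Q')_σ for an intermediate state σ_{RQ'}, then for every extension ω of σ_{RQ'} and every extension ω' of τ_{RQ''} with a common inert system F one has I(R;Q''|F)_{ω'} > I(R;Q'|F)_ω (Theorem 3 condition for genuine backflow). -/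
open Matrix
open scoped Kronecker Classical ComplexOrder

noncomputable section

/-- A density matrix: positive semidefinite with unit trace. -/
def IsState {n : Type*} [Fintype n] (ρ : Matrix n n ℂ) : Prop :=
  ρ.PosSemidef ∧ ρ.trace = 1

def IsUnitaryM {n : Type*} [Fintype n] [DecidableEq n] (U : Matrix n n ℂ) : Prop :=
  U * Uᴴ = 1 ∧ Uᴴ * U = 1

/-- Von Neumann entropy, via the eigenvalues of a Hermitian matrix. -/
noncomputable def vN {n : Type*} [Fintype n] [DecidableEq n] (ρ : Matrix n n ℂ) : ℝ :=
  if h : ρ.IsHermitian then ∑ i, Real.negMulLog (h.eigenvalues i) else 0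

/-- Partial trace over the second tensor factor. -/
def ptR {a b : Type*} [Fintype a] [Fintype b] (ρ : Matrix (a × b) (a × b) ℂ) :
    Matrix a a ℂ := Matrix.of fun i j => ∑ k, ρ (i, k) (j, k)

/-- Partial trace over the first tensor factor. -/
def ptL {a b : Type*} [Fintype a] [Fintype b] (ρ : Matrix (a × b) (a × b) ℂ) :
    Matrix b b ℂ := Matrix.of fun i j => ∑ k, ρ (k, i) (k, j)

/-- Quantum mutual information I(A;B) of a bipartite state. -/
noncomputable def MI {a b : Type*} [Fintype a] [Fintype b] [DecidableEq a] [DecidableEq b]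
    (ρ : Matrix (a × b) (a × b) ℂ) : ℝ :=
  vN (ptR ρ) + vN (ptL ρ) - vN ρ

/-- Marginal on the first two factors of a tripartite state on `a × (b × c)`. -/
def mAB {a b c : Type*} [Fintype a] [Fintype b] [Fintype c]
    (ρ : Matrix (a × b × c) (a × b × c) ℂ) : Matrix (a × b) (a × b) ℂ :=
  Matrix.of fun i j => ∑ k, ρ (i.1, (i.2, k)) (j.1, (j.2, k))

/-- Marginal on the middle factor of a tripartite state on `a × (b × c)`. -/
def mB {a b c : Type*} [Fintype a] [Fintype b] [Fintype c]
    (ρ : Matrix (a × b × c) (a × b × c) ℂ) : Matrix b b ℂ :=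
  Matrix.of fun i j => ∑ x : a, ∑ k : c, ρ (x, (i, k)) (x, (j, k))

/-- Marginal on the outer factors of a tripartite state on `a × (b × c)`. -/
def mOuter {a b c : Type*} [Fintype a] [Fintype b] [Fintype c]
    (ρ : Matrix (a × b × c) (a × b × c) ℂ) : Matrix (a × c) (a × c) ℂ :=
  Matrix.of fun i j => ∑ k : b, ρ (i.1, (k, i.2)) (j.1, (k, j.2))

/-- Quantum conditional mutual information I(A;C|B) of a state on `a × (b × c)`:
`H(AB) + H(BC) - H(B) - H(ABC)`. -/
noncomputable def CMI {a b c : Type*} [Fintype a] [Fintype b] [Fintype c]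
    [DecidableEq a] [DecidableEq b] [DecidableEq c]
    (ρ : Matrix (a × b × c) (a × b × c) ℂ) : ℝ :=
  vN (mAB ρ) + vN (ptL ρ) - vN (mB ρ) - vN ρ

/-- Squashed entanglement: half the infimum of I(A;B|E) over all finite-dimensional
extensions `ω` on `a × (E × b)` of `ρ`. -/
noncomputable def Esq {a b : Type*} [Fintype a] [Fintype b] [DecidableEq a] [DecidableEq b]
    (ρ : Matrix (a × b) (a × b) ℂ) : ℝ :=
  sInf {x : ℝ | ∃ (k : ℕ) (ω : Matrix (a × Fin k × b) (a × Fin k × b) ℂ),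
    IsState ω ∧ mOuter ω = ρ ∧ x = CMI ω / 2}

/-- Puffed entanglement: half the supremum of I(A;B|E) over all finite-dimensional
extensions `ω` on `a × (E × b)` of `ρ`. -/
noncomputable def Epuff {a b : Type*} [Fintype a] [Fintype b] [DecidableEq a] [DecidableEq b]
    (ρ : Matrix (a × b) (a × b) ℂ) : ℝ :=
  sSup {x : ℝ | ∃ (k : ℕ) (ω : Matrix (a × Fin k × b) (a × Fin k × b) ℂ),
    IsState ω ∧ mOuter ω = ρ ∧ x = CMI ω / 2}

theorem vN_eq_roots {n : Type*} [Fintype n] [DecidableEq n] {ρ : Matrix n n ℂ}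
    (h : ρ.IsHermitian) :
    vN ρ = (ρ.charpoly.roots.map (fun z : ℂ => Real.negMulLog z.re)).sum := by
  rw [vN, dif_pos h, h.roots_charpoly_eq_eigenvalues, Multiset.map_map]
  simp [Function.comp_def]

theorem vN_congr {n m : Type*} [Fintype n] [DecidableEq n] [Fintype m] [DecidableEq m]
    {ρ : Matrix n n ℂ} {σ : Matrix m m ℂ} (h : ρ.IsHermitian) (h2 : σ.IsHermitian)
    (hc : ρ.charpoly = σ.charpoly) : vN ρ = vN σ := by
  rw [vN_eq_roots h, vN_eq_roots h2, hc]

theorem vN_transpose {n : Type*} [Fintype n] [DecidableEq n] {ρ : Matrix n n ℂ}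
    (h : ρ.IsHermitian) : vN ρᵀ = vN ρ :=
  vN_congr h.transpose h (charpoly_transpose ρ)

theorem vN_mul_comm {n m : Type*} [Fintype n] [DecidableEq n] [Fintype m] [DecidableEq m]
    (M : Matrix n m ℂ) : vN (M * Mᴴ) = vN (Mᴴ * M) := by
  have h1 := isHermitian_mul_conjTranspose_self M
  have h2 := isHermitian_conjTranspose_mul_self M
  have hc := charpoly_mul_comm' M Mᴴ
  have h := congrArg (fun p : Polynomial ℂ =>
    (p.roots.map (fun z : ℂ => Real.negMulLog z.re)).sum) hc
  have e1 : (Polynomial.X ^ Fintype.card m * (M * Mᴴ).charpoly : Polynomial ℂ) ≠ 0 :=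
    mul_ne_zero (pow_ne_zero _ Polynomial.X_ne_zero) (charpoly_monic _).ne_zero
  have e2 : (Polynomial.X ^ Fintype.card n * (Mᴴ * M).charpoly : Polynomial ℂ) ≠ 0 :=
    mul_ne_zero (pow_ne_zero _ Polynomial.X_ne_zero) (charpoly_monic _).ne_zero
  simp only [Polynomial.roots_mul e1, Polynomial.roots_mul e2, Polynomial.roots_pow,
    Polynomial.roots_X, Multiset.map_add, Multiset.sum_add, Multiset.map_nsmul,
    Multiset.map_singleton, Multiset.sum_nsmul, Multiset.sum_singleton, Complex.zero_re,
    Real.negMulLog_zero, smul_zero, zero_add] at h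
  rw [vN_eq_roots h1, vN_eq_roots h2, h]

/-- Diagonal entropy in any orthonormal basis dominates the von Neumann entropy. -/
theorem vN_le_diag {n : Type*} [Fintype n] [DecidableEq n] {ρ W : Matrix n n ℂ}
    (h : ρ.PosSemidef) (hW : IsUnitaryM W) :
    vN ρ ≤ ∑ i, Real.negMulLog ((Wᴴ * ρ * W) i i).re := by
  rw [vN, dif_pos h.1]
  set lam := h.1.eigenvalues with hlam
  have hlam0 : ∀ i, 0 ≤ lam i := h.eigenvalues_nonneg
  set E : Matrix n n ℂ := (h.1.eigenvectorUnitary : Matrix n n ℂ) with hE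
  have hE1 : E * Eᴴ = 1 := mem_unitaryGroup_iff.mp h.1.eigenvectorUnitary.2
  have hE2 : Eᴴ * E = 1 := mem_unitaryGroup_iff'.mp h.1.eigenvectorUnitary.2
  have hsp : ρ = E * diagonal (fun i => (lam i : ℂ)) * Eᴴ := by
    have := h.1.spectral_theorem
    rw [Unitary.conjStarAlgAut_apply] at this
    exact this
  set G := Wᴴ * E with hG
  have hG1 : G * Gᴴ = 1 := by
    rw [hG, conjTranspose_mul, conjTranspose_conjTranspose]
    calc Wᴴ * E * (Eᴴ * W) = Wᴴ * (E * Eᴴ) * W := by simp only [Matrix.mul_assoc]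
      _ = 1 := by rw [hE1, Matrix.mul_one, hW.2]
  have hG2 : Gᴴ * G = 1 := by
    rw [hG, conjTranspose_mul, conjTranspose_conjTranspose]
    calc Eᴴ * W * (Wᴴ * E) = Eᴴ * (W * Wᴴ) * E := by simp only [Matrix.mul_assoc]
      _ = 1 := by rw [hW.1, Matrix.mul_one, hE2]
  have hK : Wᴴ * ρ * W = G * diagonal (fun i => (lam i : ℂ)) * Gᴴ := by
    rw [hG, conjTranspose_mul, conjTranspose_conjTranspose, hsp]
    simp only [Matrix.mul_assoc]
  have hrow : ∀ i, ∑ k, Complex.normSq (G i k) = 1 := by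
    intro i
    have := congrFun (congrFun hG1 i) i
    simp only [mul_apply, conjTranspose_apply, one_apply_eq, RCLike.star_def,
      Complex.mul_conj] at this
    exact_mod_cast this
  have hcol : ∀ k, ∑ i, Complex.normSq (G i k) = 1 := by
    intro k
    have := congrFun (congrFun hG2 k) k
    simp only [mul_apply, conjTranspose_apply, one_apply_eq, RCLike.star_def,
      mul_comm, Complex.mul_conj] at this
    exact_mod_cast this
  have hent : ∀ i, ((Wᴴ * ρ * W) i i).re = ∑ k, Complex.normSq (G i k) * lam k := by
    intro i
    rw [hK, mul_apply, Complex.re_sum]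
    refine Finset.sum_congr rfl fun k _ => ?_
    rw [mul_diagonal, conjTranspose_apply, RCLike.star_def, mul_right_comm, Complex.mul_conj]
    simp
  calc ∑ k, Real.negMulLog (lam k)
      = ∑ k, (∑ i, Complex.normSq (G i k)) * Real.negMulLog (lam k) := by simp [hcol]
    _ = ∑ i, ∑ k, Complex.normSq (G i k) * Real.negMulLog (lam k) := by
        simp only [Finset.sum_mul]; exact Finset.sum_comm
    _ ≤ _ := by
        refine Finset.sum_le_sum fun i _ => ?_
        rw [hent]
        have := Real.concaveOn_negMulLog.le_map_sum (t := Finset.univ)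
          (w := fun k => Complex.normSq (G i k)) (p := lam)
          (fun k _ => Complex.normSq_nonneg _) (hrow i) (fun k _ => hlam0 k)
        simpa [smul_eq_mul] using this

theorem classical_subadd {a b : Type*} [Fintype a] [Fintype b] (r : a × b → ℝ)
    (h0 : ∀ x, 0 ≤ r x) (h1 : ∑ x, r x = 1) :
    ∑ x, Real.negMulLog (r x) ≤ ∑ i, Real.negMulLog (∑ j, r (i, j))
      + ∑ j, Real.negMulLog (∑ i, r (i, j)) := by
  set p : a → ℝ := fun i => ∑ j, r (i, j) with hp
  set q : b → ℝ := fun j => ∑ i, r (i, j) with hq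
  have hp0 : ∀ i, 0 ≤ p i := fun i => Finset.sum_nonneg fun j _ => h0 _
  have hq0 : ∀ j, 0 ≤ q j := fun j => Finset.sum_nonneg fun i _ => h0 _
  have hp1 : ∑ i, p i = 1 := by rw [← h1, Fintype.sum_prod_type]
  have hq1 : ∑ j, q j = 1 := by rw [← h1, Fintype.sum_prod_type_right]
  have key : ∀ i j, Real.negMulLog (r (i, j)) ≤
      -(r (i, j) * Real.log (p i)) + -(r (i, j) * Real.log (q j)) + (p i * q j - r (i, j)) := by
    intro i j
    rcases (h0 (i, j)).eq_or_lt with hr | hr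
    · rw [← hr]; simp; exact mul_nonneg (hp0 i) (hq0 j)
    · have hpi : 0 < p i := hr.trans_le
        (Finset.single_le_sum (f := fun j => r (i, j)) (fun j _ => h0 _) (Finset.mem_univ j))
      have hqj : 0 < q j := hr.trans_le
        (Finset.single_le_sum (f := fun i => r (i, j)) (fun j _ => h0 _) (Finset.mem_univ i))
      have hl := Real.log_le_sub_one_of_pos (div_pos (mul_pos hpi hqj) hr)
      rw [Real.log_div (mul_pos hpi hqj).ne' hr.ne', Real.log_mul hpi.ne' hqj.ne'] at hl
      have h3 := mul_le_mul_of_nonneg_left hl hr.le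
      have h4 : r (i, j) * (p i * q j / r (i, j) - 1) = p i * q j - r (i, j) := by
        field_simp
      rw [h4] at h3
      rw [Real.negMulLog]
      linarith
  rw [Fintype.sum_prod_type]
  refine (Finset.sum_le_sum fun i _ => Finset.sum_le_sum fun j _ => key i j).trans ?_
  simp only [Finset.sum_add_distrib, Finset.sum_sub_distrib]
  have t1 : ∑ i, ∑ j, -(r (i, j) * Real.log (p i)) = ∑ i, Real.negMulLog (p i) := by
    refine Finset.sum_congr rfl fun i _ => ?_
    rw [Finset.sum_neg_distrib, ← Finset.sum_mul, Real.negMulLog, neg_mul]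
  have t2 : ∑ i, ∑ j, -(r (i, j) * Real.log (q j)) = ∑ j, Real.negMulLog (q j) := by
    rw [Finset.sum_comm]
    refine Finset.sum_congr rfl fun j _ => ?_
    rw [Finset.sum_neg_distrib, ← Finset.sum_mul, Real.negMulLog, neg_mul]
  have t3 : ∑ i, ∑ j, p i * q j = 1 := by
    rw [← Finset.sum_mul_sum, hp1, hq1, one_mul]
  have t4 : ∑ i, ∑ j, r (i, j) = 1 := hp1
  rw [t1, t2, t3, t4, sub_self, add_zero]

theorem diag_ptR {a b : Type*} [Fintype a] [Fintype b] [DecidableEq a] [DecidableEq b]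
    (ρ : Matrix (a × b) (a × b) ℂ) (U : Matrix a a ℂ) (V : Matrix b b ℂ) (hV : IsUnitaryM V)
    (i : a) :
    ∑ j, ((U ⊗ₖ V)ᴴ * ρ * (U ⊗ₖ V)) (i, j) (i, j) = (Uᴴ * ptR ρ * U) i i := by
  have hd : ∀ y x, ∑ j, V y j * star (V x j) = if y = x then 1 else 0 := by
    intro y x
    have := congrFun (congrFun hV.1 y) x
    simpa only [mul_apply, conjTranspose_apply, one_apply] using this
  calc ∑ j, ((U ⊗ₖ V)ᴴ * ρ * (U ⊗ₖ V)) (i, j) (i, j)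
      = ∑ j, ∑ y : a × b, ∑ x : a × b, (star (U x.1 i) * ρ x y * U y.1 i) *
          (V y.2 j * star (V x.2 j)) := by
        refine Finset.sum_congr rfl fun j _ => ?_
        simp only [mul_apply, conjTranspose_apply, kroneckerMap_apply, Finset.sum_mul, star_mul']
        refine Finset.sum_congr rfl fun y _ => Finset.sum_congr rfl fun x _ => ?_
        ring
    _ = ∑ y : a × b, ∑ x : a × b, (star (U x.1 i) * ρ x y * U y.1 i) *
          (if y.2 = x.2 then 1 else 0) := by
        rw [Finset.sum_comm]
        refine Finset.sum_congr rfl fun y _ => ?_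
        rw [Finset.sum_comm]
        refine Finset.sum_congr rfl fun x _ => ?_
        rw [← Finset.mul_sum, hd]
    _ = _ := by
        simp only [Fintype.sum_prod_type, mul_ite, mul_one, mul_zero, Finset.sum_ite_eq,
          Finset.mem_univ, if_true, mul_apply, conjTranspose_apply, ptR, of_apply,
          Finset.sum_mul, Finset.mul_sum]
        refine Finset.sum_congr rfl fun y _ => Finset.sum_comm

theorem diag_ptL {a b : Type*} [Fintype a] [Fintype b] [DecidableEq a] [DecidableEq b]
    (ρ : Matrix (a × b) (a × b) ℂ) (U : Matrix a a ℂ) (V : Matrix b b ℂ) (hU : IsUnitaryM U)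
    (j : b) :
    ∑ i, ((U ⊗ₖ V)ᴴ * ρ * (U ⊗ₖ V)) (i, j) (i, j) = (Vᴴ * ptL ρ * V) j j := by
  have hd : ∀ y x, ∑ j, U y j * star (U x j) = if y = x then 1 else 0 := by
    intro y x
    have := congrFun (congrFun hU.1 y) x
    simpa only [mul_apply, conjTranspose_apply, one_apply] using this
  calc ∑ i, ((U ⊗ₖ V)ᴴ * ρ * (U ⊗ₖ V)) (i, j) (i, j)
      = ∑ i, ∑ y : a × b, ∑ x : a × b, (star (V x.2 j) * ρ x y * V y.2 j) *
          (U y.1 i * star (U x.1 i)) := by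
        refine Finset.sum_congr rfl fun i _ => ?_
        simp only [mul_apply, conjTranspose_apply, kroneckerMap_apply, Finset.sum_mul, star_mul']
        refine Finset.sum_congr rfl fun y _ => Finset.sum_congr rfl fun x _ => ?_
        ring
    _ = ∑ y : a × b, ∑ x : a × b, (star (V x.2 j) * ρ x y * V y.2 j) *
          (if y.1 = x.1 then 1 else 0) := by
        rw [Finset.sum_comm]
        refine Finset.sum_congr rfl fun y _ => ?_
        rw [Finset.sum_comm]
        refine Finset.sum_congr rfl fun x _ => ?_
        rw [← Finset.mul_sum, hd]
    _ = _ := by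
        simp only [Fintype.sum_prod_type_right, mul_ite, mul_one, mul_zero, Finset.sum_ite_eq,
          Finset.mem_univ, if_true, mul_apply, conjTranspose_apply, ptL, of_apply,
          Finset.sum_mul, Finset.mul_sum]
        refine Finset.sum_congr rfl fun y _ => Finset.sum_comm

theorem posSemidef_ptR {a b : Type*} [Fintype a] [Fintype b]
    {ρ : Matrix (a × b) (a × b) ℂ} (h : ρ.PosSemidef) : (ptR ρ).PosSemidef := by
  have : ptR ρ = ∑ k, ρ.submatrix (fun i => (i, k)) (fun i => (i, k)) := by
    ext i j; simp [ptR, Matrix.sum_apply]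
  rw [this]
  exact posSemidef_sum _ fun k _ => h.submatrix _

theorem posSemidef_ptL {a b : Type*} [Fintype a] [Fintype b]
    {ρ : Matrix (a × b) (a × b) ℂ} (h : ρ.PosSemidef) : (ptL ρ).PosSemidef := by
  have : ptL ρ = ∑ k, ρ.submatrix (fun i => (k, i)) (fun i => (k, i)) := by
    ext i j; simp [ptL, Matrix.sum_apply]
  rw [this]
  exact posSemidef_sum _ fun k _ => h.submatrix _

theorem trace_ptL {a b : Type*} [Fintype a] [Fintype b]
    (ρ : Matrix (a × b) (a × b) ℂ) : (ptL ρ).trace = ρ.trace := by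
  simp [trace, ptL, Fintype.sum_prod_type_right]

theorem isState_ptL {a b : Type*} [Fintype a] [Fintype b]
    {ρ : Matrix (a × b) (a × b) ℂ} (h : IsState ρ) : IsState (ptL ρ) :=
  ⟨posSemidef_ptL h.1, by rw [trace_ptL, h.2]⟩

/-- A unitary diagonalising a Hermitian matrix computes its entropy. -/
theorem exists_diag {n : Type*} [Fintype n] [DecidableEq n] {ρ : Matrix n n ℂ}
    (h : ρ.IsHermitian) : ∃ U : Matrix n n ℂ, IsUnitaryM U ∧
      vN ρ = ∑ i, Real.negMulLog ((Uᴴ * ρ * U) i i).re := by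
  refine ⟨(h.eigenvectorUnitary : Matrix n n ℂ), ⟨mem_unitaryGroup_iff.mp h.eigenvectorUnitary.2,
    mem_unitaryGroup_iff'.mp h.eigenvectorUnitary.2⟩, ?_⟩
  have h2 := h.conjStarAlgAut_star_eigenvectorUnitary
  rw [Unitary.conjStarAlgAut_apply] at h2
  have h3 : (h.eigenvectorUnitary : Matrix n n ℂ)ᴴ * ρ * (h.eigenvectorUnitary : Matrix n n ℂ)
      = diagonal (RCLike.ofReal ∘ h.eigenvalues) := by
    rw [← h2]
    simp [star_eq_conjTranspose]
  rw [h3, vN, dif_pos h]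
  simp

theorem vN_subadd {a b : Type*} [Fintype a] [Fintype b] [DecidableEq a] [DecidableEq b]
    {ρ : Matrix (a × b) (a × b) ℂ} (h : IsState ρ) : vN ρ ≤ vN (ptR ρ) + vN (ptL ρ) := by
  obtain ⟨U, hU, eU⟩ := exists_diag (posSemidef_ptR h.1).1
  obtain ⟨V, hV, eV⟩ := exists_diag (posSemidef_ptL h.1).1
  have hW : IsUnitaryM (U ⊗ₖ V) := by
    constructor
    · rw [conjTranspose_kronecker, ← mul_kronecker_mul, hU.1, hV.1, one_kronecker_one]
    · rw [conjTranspose_kronecker, ← mul_kronecker_mul, hU.2, hV.2, one_kronecker_one]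
  have hK : ((U ⊗ₖ V)ᴴ * ρ * (U ⊗ₖ V)).PosSemidef := h.1.conjTranspose_mul_mul_same _
  have htr : ((U ⊗ₖ V)ᴴ * ρ * (U ⊗ₖ V)).trace = 1 := by
    rw [trace_mul_comm, ← Matrix.mul_assoc, hW.1, Matrix.one_mul, h.2]
  refine (vN_le_diag h.1 hW).trans ?_
  have := classical_subadd (fun x => (((U ⊗ₖ V)ᴴ * ρ * (U ⊗ₖ V)) x x).re)
    (fun x => (Complex.le_def.mp (hK.diag_nonneg (i := x))).1) (by
      rw [← Complex.re_sum]
      have := congrArg Complex.re htr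
      simpa [trace] using this)
  refine this.trans (le_of_eq ?_)
  rw [eU, eV]
  congr 1
  · refine Finset.sum_congr rfl fun i _ => ?_
    rw [← Complex.re_sum, diag_ptR ρ U V hV]
  · refine Finset.sum_congr rfl fun i _ => ?_
    rw [← Complex.re_sum, diag_ptL ρ U V hU]

open scoped MatrixOrder Matrix.Norms.L2Operator in
theorem exists_factor {n : Type*} [Fintype n] [DecidableEq n] {ρ : Matrix n n ℂ}
    (h : ρ.PosSemidef) : ∃ M : Matrix n n ℂ, ρ = M * Mᴴ := by
  obtain ⟨B, hB⟩ := CStarAlgebra.nonneg_iff_eq_star_mul_self.mp h.nonneg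
  exact ⟨Bᴴ, by rw [hB, conjTranspose_conjTranspose, star_eq_conjTranspose]⟩

/-- The Araki-Lieb inequality. -/
theorem araki_lieb {a b : Type*} [Fintype a] [Fintype b] [DecidableEq a] [DecidableEq b]
    {ρ : Matrix (a × b) (a × b) ℂ} (h : IsState ρ) : vN (ptR ρ) ≤ vN (ptL ρ) + vN ρ := by
  obtain ⟨M, hM⟩ := exists_factor h.1
  let N : Matrix a (b × (a × b)) ℂ := Matrix.of fun x y => M (x, y.1) y.2
  have e1 : ptR ρ = N * Nᴴ := by
    ext i j
    simp [hM, ptR, N, mul_apply, Fintype.sum_prod_type]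
  have e2 : ptR (Nᴴ * N) = (ptL ρ)ᵀ := by
    ext i j
    simp only [hM, ptR, ptL, N, mul_apply, of_apply, transpose_apply, conjTranspose_apply]
    rw [Finset.sum_comm]
    refine Finset.sum_congr rfl fun x _ => Finset.sum_congr rfl fun y _ => mul_comm _ _
  have e3 : ptL (Nᴴ * N) = Mᴴ * M := by
    ext i j
    simp only [ptL, N, mul_apply, of_apply, conjTranspose_apply]
    rw [Fintype.sum_prod_type_right]
  have hst : IsState (Nᴴ * N) :=
    ⟨posSemidef_conjTranspose_mul_self N, by
      rw [← trace_ptL, e3, trace_mul_comm, ← hM, h.2]⟩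
  calc vN (ptR ρ) = vN (Nᴴ * N) := by rw [e1, vN_mul_comm]
    _ ≤ vN (ptR (Nᴴ * N)) + vN (ptL (Nᴴ * N)) := vN_subadd hst
    _ = vN (ptL ρ) + vN ρ := by
      rw [e2, e3, vN_transpose (posSemidef_ptL h.1).1, ← vN_mul_comm, ← hM]

theorem vN_nonneg {n : Type*} [Fintype n] [DecidableEq n] {ρ : Matrix n n ℂ}
    (h : IsState ρ) : 0 ≤ vN ρ := by
  rw [vN, dif_pos h.1.1]
  have hs : ∑ i, h.1.1.eigenvalues i = 1 := by
    have := h.1.1.trace_eq_sum_eigenvalues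
    have h2 := this.symm.trans h.2
    have h3 := congrArg Complex.re h2
    simpa using h3
  refine Finset.sum_nonneg fun i _ => Real.negMulLog_nonneg (h.1.eigenvalues_nonneg i) ?_
  rw [← hs]
  exact Finset.single_le_sum (f := h.1.1.eigenvalues) (fun j _ => h.1.eigenvalues_nonneg j)
    (Finset.mem_univ i)

theorem CMI_le {a b c : Type*} [Fintype a] [Fintype b] [Fintype c]
    [DecidableEq a] [DecidableEq b] [DecidableEq c]
    {ω : Matrix (a × b × c) (a × b × c) ℂ} (h : IsState ω) :
    CMI ω ≤ 2 * vN (ptL (mOuter ω)) := by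
  have s1 := vN_subadd (isState_ptL h)
  have e1 : ptR (ptL ω) = mB ω := by
    ext i j
    simp only [ptR, ptL, mB, of_apply]
    exact Finset.sum_comm
  have e2 : ptL (ptL ω) = ptL (mOuter ω) := by
    ext i j
    simp only [ptL, mOuter, of_apply]
    exact Finset.sum_comm
  let ω₂ : Matrix ((a × b) × c) ((a × b) × c) ℂ :=
    reindex (Equiv.prodAssoc a b c).symm (Equiv.prodAssoc a b c).symm ω
  have hps : ω₂.PosSemidef := h.1.submatrix _
  have htr : ω₂.trace = 1 := by
    rw [← h.2]
    simp [ω₂, trace, Fintype.sum_prod_type]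
  have s2 := araki_lieb (ρ := ω₂) ⟨hps, htr⟩
  have e3 : ptR ω₂ = mAB ω := by
    ext i j
    simp [ptR, mAB, ω₂]
  have e4 : ptL ω₂ = ptL (mOuter ω) := by
    ext i j
    simp [ptL, mOuter, ω₂, Fintype.sum_prod_type]
  have e5 : vN ω₂ = vN ω := vN_congr hps.1 h.1.1 (charpoly_reindex _ _)
  rw [e1, e2] at s1
  rw [e3, e4, e5] at s2
  rw [CMI]
  linarith

/-- Transitivity `E_sq(A;B')_τ ≤ E_sq(A;B)_ρ ≤ E_puff(A;B)_ρ ⟹ E_sq(A;B')_τ ≤ E_puff(A;B)_ρ`;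
and, in particular, if `E_sq(R;Q'')_τ > H(Q')_σ` then for every pair of extensions with a
common inert system `F = Fin k`, `I(R;Q'|F)_ω < I(R;Q''|F)_{ω'}`. -/
theorem esq_epuff_genuine_backflow {R Q Q2 : Type*}
    [Fintype R] [Fintype Q] [Fintype Q2] [DecidableEq R] [DecidableEq Q] [DecidableEq Q2] :
    (∀ (ρ : Matrix (R × Q) (R × Q) ℂ) (τ : Matrix (R × Q2) (R × Q2) ℂ),
      Esq τ ≤ Esq ρ → Esq ρ ≤ Epuff ρ → Esq τ ≤ Epuff ρ)
    ∧
    (∀ (σ : Matrix (R × Q) (R × Q) ℂ) (τ : Matrix (R × Q2) (R × Q2) ℂ),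
      IsState σ → IsState τ → vN (ptL σ) < Esq τ →
      ∀ (k : ℕ) (ω : Matrix (R × Fin k × Q) (R × Fin k × Q) ℂ)
        (ω' : Matrix (R × Fin k × Q2) (R × Fin k × Q2) ℂ),
        IsState ω → IsState ω' → mOuter ω = σ → mOuter ω' = τ →
        CMI ω < CMI ω') := by 
  refine ⟨fun ρ τ h1 h2 => h1.trans h2, ?_⟩
  intro σ τ hσ _ hlt k ω ω' hω hω' eω eω'
  have hup : CMI ω ≤ 2 * vN (ptL σ) := by
    have := CMI_le hω
    rwa [eω] at this
  have h0 : 0 ≤ vN (ptL σ) := vN_nonneg (isState_ptL hσ)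
  have hlow : Esq τ ≤ CMI ω' / 2 := by
    by_cases hb : BddBelow {x : ℝ | ∃ (k : ℕ) (ω : Matrix (R × Fin k × Q2) (R × Fin k × Q2) ℂ),
        IsState ω ∧ mOuter ω = τ ∧ x = CMI ω / 2}
    · exact csInf_le hb ⟨k, ω', hω', eω', rfl⟩
    · have hz : Esq τ = 0 := Real.sInf_of_not_bddBelow hb
      linarith
  linarith
end
end

section
/- If σ_{RQ'E'F} satisfies I(R;E'|Q'F)_σ ≤ ε for some ε ≥ 0, then for every unitary V on Q'⊗E' with output τ = (1_{RF}⊗V)σ(1_{RF}⊗V)†, the mutual-information revival relative to F is bounded: I(R;Q''F)_τ − I(R;Q'F)_σ ≤ ε. -/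
open Matrix
open scoped Kronecker Classical ComplexOrder

noncomputable section

/-- Marginal on `R (Q F)` of a four-partite state on `R × (Q × (E × F))`. -/
def mRQF {R Q E F : Type*} [Fintype R] [Fintype Q] [Fintype E] [Fintype F]
    (σ : Matrix (R × Q × E × F) (R × Q × E × F) ℂ) : Matrix (R × Q × F) (R × Q × F) ℂ :=
  Matrix.of fun i j => ∑ e : E, σ (i.1, (i.2.1, (e, i.2.2))) (j.1, (j.2.1, (e, j.2.2)))

/-- Marginal on `(Q F)` of a four-partite state on `R × (Q × (E × F))`. -/
def mQF {R Q E F : Type*} [Fintype R] [Fintype Q] [Fintype E] [Fintype F]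
    (σ : Matrix (R × Q × E × F) (R × Q × E × F) ℂ) : Matrix (Q × F) (Q × F) ℂ :=
  Matrix.of fun i j => ∑ r : R, ∑ e : E, σ (r, (i.1, (e, i.2))) (r, (j.1, (e, j.2)))

/-- Marginal on `(R F)` of a four-partite state on `R × (Q × (E × F))`. -/
def mRF4 {R Q E F : Type*} [Fintype R] [Fintype Q] [Fintype E] [Fintype F]
    (σ : Matrix (R × Q × E × F) (R × Q × E × F) ℂ) : Matrix (R × F) (R × F) ℂ :=
  Matrix.of fun i j => ∑ q : Q, ∑ e : E, σ (i.1, (q, (e, i.2))) (j.1, (q, (e, j.2)))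

/-- Marginal on `F` of a four-partite state on `R × (Q × (E × F))`. -/
def mF4 {R Q E F : Type*} [Fintype R] [Fintype Q] [Fintype E] [Fintype F]
    (σ : Matrix (R × Q × E × F) (R × Q × E × F) ℂ) : Matrix F F ℂ :=
  Matrix.of fun i j => ∑ r : R, ∑ q : Q, ∑ e : E, σ (r, (q, (e, i))) (r, (q, (e, j)))

/-- Marginal on `R (Q E)` of a four-partite state on `R × (Q × (E × F))`. -/
def mRQE4 {R Q E F : Type*} [Fintype R] [Fintype Q] [Fintype E] [Fintype F]
    (σ : Matrix (R × Q × E × F) (R × Q × E × F) ℂ) : Matrix (R × Q × E) (R × Q × E) ℂ :=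
  Matrix.of fun i j => ∑ f : F, σ (i.1, (i.2.1, (i.2.2, f))) (j.1, (j.2.1, (j.2.2, f)))

/-- Marginal on `(R Q)` of a four-partite state on `R × (Q × (E × F))`. -/
def mRQ4 {R Q E F : Type*} [Fintype R] [Fintype Q] [Fintype E] [Fintype F]
    (σ : Matrix (R × Q × E × F) (R × Q × E × F) ℂ) : Matrix (R × Q) (R × Q) ℂ :=
  Matrix.of fun i j => ∑ e : E, ∑ f : F, σ (i.1, (i.2, (e, f))) (j.1, (j.2, (e, f)))

/-- Conditional mutual information I(R;E|QF) of a four-partite state on `R × (Q × (E × F))`. -/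
noncomputable def IREQF {R Q E F : Type*} [Fintype R] [Fintype Q] [Fintype E] [Fintype F]
    [DecidableEq R] [DecidableEq Q] [DecidableEq E] [DecidableEq F]
    (σ : Matrix (R × Q × E × F) (R × Q × E × F) ℂ) : ℝ :=
  vN (mRQF σ) + vN (ptL σ) - vN (mQF σ) - vN σ

/-- Lift a unitary acting on `Q × E` to the full space `R × (Q × (E × F))`, acting as the
identity on `R` and `F`. -/
def liftQE {R Q E F : Type*} [Fintype R] [Fintype Q] [Fintype E] [Fintype F]
    [DecidableEq R] [DecidableEq Q] [DecidableEq E] [DecidableEq F]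
    (V : Matrix (Q × E) (Q × E) ℂ) : Matrix (R × Q × E × F) (R × Q × E × F) ℂ :=
  (1 : Matrix R R ℂ) ⊗ₖ ((V ⊗ₖ (1 : Matrix F F ℂ)).submatrix
    (Equiv.prodAssoc Q E F).symm (Equiv.prodAssoc Q E F).symm)


lemma my_hder {μ : Type*} [Fintype μ] (w p s : μ → ℝ) (hp : ∀ x, 0 ≤ p x) (hs : ∀ x, 0 < s x)
    (t : ℝ) (ht : 0 ≤ t) : HasDerivAt (fun t => ∑ x, w x * (p x * Real.log (s x + t * p x)))
        (∑ x, w x * (p x ^ 2 / (s x + t * p x))) t := by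
  refine HasDerivAt.fun_sum fun x _ => ?_
  have hpos : s x + t * p x ≠ 0 := by have := hs x; have := mul_nonneg ht (hp x); positivity
  have h1 : HasDerivAt (fun t => s x + t * p x) (p x) t := by
    simpa using ((hasDerivAt_id t).mul_const (p x)).const_add (s x)
  refine (((h1.log hpos).const_mul (p x)).const_mul (w x)).congr_deriv ?_
  ring

lemma my_scalar {ι κ : Type*} [Fintype ι] [Fintype κ] (w p s : ι → ℝ) (w' p' s' : κ → ℝ)
    (hp : ∀ x, 0 ≤ p x) (hs : ∀ x, 0 < s x) (hp' : ∀ x, 0 ≤ p' x) (hs' : ∀ x, 0 < s' x)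
    (hsum : ∑ x, w x * p x = ∑ x, w' x * p' x)
    (hφ : ∀ t : ℝ, 0 ≤ t → ∑ x, w' x * (p' x ^ 2 / (s' x + t * p' x))
      ≤ ∑ x, w x * (p x ^ 2 / (s x + t * p x))) :
    ∑ x, w x * (p x * Real.log (s x)) - ∑ x, w' x * (p' x * Real.log (s' x)) ≤
    ∑ x, w x * (p x * Real.log (p x)) - ∑ x, w' x * (p' x * Real.log (p' x)) := by
  have hlim1 : ∀ (p s : ℝ), 0 ≤ p → 0 < s → Filter.Tendsto
      (fun t : ℝ => p * Real.log (s + t * p) - p * Real.log t) Filter.atTop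
      (nhds (p * Real.log p)) := by
    intro p s hp hs
    rcases hp.eq_or_lt with rfl | hp
    · simp
    have h1 : Filter.Tendsto (fun t : ℝ => p * Real.log (s / t + p)) Filter.atTop
        (nhds (p * Real.log p)) := by
      have h2 : Filter.Tendsto (fun t : ℝ => s / t + p) Filter.atTop (nhds (0 + p)) :=
        (tendsto_const_nhds.div_atTop Filter.tendsto_id).add tendsto_const_nhds
      rw [zero_add] at h2
      exact ((Real.continuousAt_log hp.ne').tendsto.comp h2).const_mul p
    refine h1.congr' ?_
    filter_upwards [Filter.eventually_gt_atTop 0] with t ht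
    rw [← mul_sub, ← Real.log_div (by positivity) (by positivity)]
    congr 2
    field_simp
  set h : ℝ → ℝ := fun t => ∑ x, w x * (p x * Real.log (s x + t * p x)) -
      ∑ x, w' x * (p' x * Real.log (s' x + t * p' x)) with hh
  have hd : ∀ t, 0 ≤ t → HasDerivAt h _ t := fun t ht =>
    (my_hder w p s hp hs t ht).sub (my_hder w' p' s' hp' hs' t ht)
  have hmono : MonotoneOn h (Set.Ici 0) := by
    apply monotoneOn_of_deriv_nonneg (convex_Ici 0)
    · exact fun t ht => (hd t ht).continuousAt.continuousWithinAt
    · intro t ht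
      rw [interior_Ici] at ht
      exact (hd t (le_of_lt ht)).differentiableAt.differentiableWithinAt
    · intro t ht
      rw [interior_Ici] at ht
      rw [(hd t (le_of_lt ht)).deriv]
      have := hφ t (le_of_lt ht)
      linarith
  have hlim : Filter.Tendsto h Filter.atTop (nhds (∑ x, w x * (p x * Real.log (p x)) -
      ∑ x, w' x * (p' x * Real.log (p' x)))) := by
    have e : h = fun t => ∑ x, w x * (p x * Real.log (s x + t * p x) - p x * Real.log t) -
      ∑ x, w' x * (p' x * Real.log (s' x + t * p' x) - p' x * Real.log t) := by
      funext t
      simp only [hh, mul_sub, Finset.sum_sub_distrib, ← mul_assoc, ← Finset.sum_mul, hsum]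
      ring
    rw [e]
    exact (tendsto_finsetSum _ fun x _ => (hlim1 _ _ (hp x) (hs x)).const_mul _).sub
      (tendsto_finsetSum _ fun x _ => (hlim1 _ _ (hp' x) (hs' x)).const_mul _)
  have h0 : h 0 = ∑ x, w x * (p x * Real.log (s x)) - ∑ x, w' x * (p' x * Real.log (s' x)) := by
    simp [hh]
  rw [← h0]
  refine ge_of_tendsto hlim ?_
  filter_upwards [Filter.eventually_ge_atTop 0] with t ht
  exact hmono (Set.mem_Ici.2 le_rfl) ht ht

/-- The variational functional. -/
def myJ {n : Type*} [Fintype n] (ρ σ : Matrix n n ℂ) (t : ℝ) (Y : Matrix n n ℂ) : ℝ :=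
  2 * (ρ * Yᴴ).trace.re - (σ * (Y * Yᴴ)).trace.re - t * (ρ * (Yᴴ * Y)).trace.re

lemma my_J_eq {n : Type*} [Fintype n] [DecidableEq n] (U W y : Matrix n n ℂ) (p s : n → ℝ)
    (hU : Uᴴ * U = 1) (hW : Wᴴ * W = 1) (t : ℝ) :
    myJ (U * diagonal (fun i => (p i : ℂ)) * Uᴴ) (W * diagonal (fun i => (s i : ℂ)) * Wᴴ) t
      (W * y * Uᴴ) = ∑ x : n × n, (2 * p x.2 * (star (y x.1 x.2) * (Wᴴ * U) x.1 x.2).re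
        - (s x.1 + t * p x.2) * Complex.normSq (y x.1 x.2)) := by
  have e1 : (U * diagonal (fun i => (p i : ℂ)) * Uᴴ * (W * y * Uᴴ)ᴴ).trace =
      ∑ x : n × n, (p x.2 : ℂ) * (star (y x.1 x.2) * (Wᴴ * U) x.1 x.2) := by
    have : U * diagonal (fun i => (p i : ℂ)) * Uᴴ * (W * y * Uᴴ)ᴴ
        = U * (diagonal (fun i => (p i : ℂ)) * (yᴴ * Wᴴ)) := by
      simp only [conjTranspose_mul, conjTranspose_conjTranspose, Matrix.mul_assoc]
      rw [← Matrix.mul_assoc Uᴴ U, hU, Matrix.one_mul]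
    rw [this, trace_mul_comm, Matrix.mul_assoc, Matrix.mul_assoc, Fintype.sum_prod_type_right]
    simp only [trace, diag, diagonal_mul, Matrix.mul_apply (M := yᴴ), conjTranspose_apply, Finset.mul_sum]
  have e2 : (W * diagonal (fun i => (s i : ℂ)) * Wᴴ * ((W * y * Uᴴ) * (W * y * Uᴴ)ᴴ)).trace =
      ∑ x : n × n, (s x.1 : ℂ) * (y x.1 x.2 * star (y x.1 x.2)) := by
    have : W * diagonal (fun i => (s i : ℂ)) * Wᴴ * ((W * y * Uᴴ) * (W * y * Uᴴ)ᴴ)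
        = W * (diagonal (fun i => (s i : ℂ)) * (y * yᴴ) * Wᴴ) := by
      simp only [conjTranspose_mul, conjTranspose_conjTranspose, Matrix.mul_assoc]
      rw [← Matrix.mul_assoc Uᴴ U, hU, Matrix.one_mul, ← Matrix.mul_assoc Wᴴ W, hW, Matrix.one_mul]
    rw [this, trace_mul_comm, Matrix.mul_assoc, hW, Matrix.mul_one, Fintype.sum_prod_type]
    simp only [trace, diag, diagonal_mul, Matrix.mul_apply (M := y), conjTranspose_apply, Finset.mul_sum]
  have e3 : (U * diagonal (fun i => (p i : ℂ)) * Uᴴ * ((W * y * Uᴴ)ᴴ * (W * y * Uᴴ))).trace =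
      ∑ x : n × n, (p x.2 : ℂ) * (star (y x.1 x.2) * y x.1 x.2) := by
    have : U * diagonal (fun i => (p i : ℂ)) * Uᴴ * ((W * y * Uᴴ)ᴴ * (W * y * Uᴴ))
        = U * (diagonal (fun i => (p i : ℂ)) * (yᴴ * y) * Uᴴ) := by
      simp only [conjTranspose_mul, conjTranspose_conjTranspose, Matrix.mul_assoc]
      rw [← Matrix.mul_assoc Uᴴ U, hU, Matrix.one_mul, ← Matrix.mul_assoc Wᴴ W, hW, Matrix.one_mul]
    rw [this, trace_mul_comm, Matrix.mul_assoc, hU, Matrix.mul_one, Fintype.sum_prod_type_right]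
    simp only [trace, diag, diagonal_mul, Matrix.mul_apply (M := yᴴ), conjTranspose_apply, Finset.mul_sum]
  rw [myJ, e1, e2, e3]
  simp only [Complex.re_sum, Finset.mul_sum, ← Finset.sum_sub_distrib]
  refine Finset.sum_congr rfl fun x _ => ?_
  simp only [Complex.re_ofReal_mul, Complex.star_def, Complex.mul_conj, ← Complex.normSq_eq_conj_mul_self, Complex.ofReal_re]
  ring

lemma my_J_le {n : Type*} [Fintype n] [DecidableEq n] (U W Y : Matrix n n ℂ) (p s : n → ℝ)
    (hU : Uᴴ * U = 1) (hW : Wᴴ * W = 1) (hp : ∀ x, 0 ≤ p x) (hs : ∀ x, 0 < s x)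
    (t : ℝ) (ht : 0 ≤ t) :
    myJ (U * diagonal (fun i => (p i : ℂ)) * Uᴴ) (W * diagonal (fun i => (s i : ℂ)) * Wᴴ) t Y
      ≤ ∑ x : n × n, Complex.normSq ((Wᴴ * U) x.1 x.2) * (p x.2 ^ 2 / (s x.1 + t * p x.2)) := by
  have hY : Y = W * (Wᴴ * Y * U) * Uᴴ := by
    have hU' := mul_eq_one_comm.1 hU
    have hW' := mul_eq_one_comm.1 hW
    simp only [Matrix.mul_assoc, hU', Matrix.mul_one]
    rw [← Matrix.mul_assoc, hW', Matrix.one_mul]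
  rw [hY, my_J_eq _ _ _ _ _ hU hW]
  refine Finset.sum_le_sum fun x _ => ?_
  have hpos : 0 < s x.1 + t * p x.2 := by
    have := hs x.1; have := mul_nonneg ht (hp x.2); positivity
  generalize (Wᴴ * U) x.1 x.2 = c
  generalize (Wᴴ * Y * U) x.1 x.2 = y
  generalize s x.1 + t * p x.2 = a at *
  generalize p x.2 = q at *
  rw [← mul_div_assoc, le_div_iff₀ hpos]
  simp only [Complex.normSq_apply, Complex.mul_re, Complex.star_def, Complex.conj_re, Complex.conj_im]
  nlinarith [sq_nonneg (a * y.re - q * c.re), sq_nonneg (a * y.im - q * c.im)]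

lemma my_J_attained {n : Type*} [Fintype n] [DecidableEq n] (U W : Matrix n n ℂ) (p s : n → ℝ)
    (hU : Uᴴ * U = 1) (hW : Wᴴ * W = 1) (hp : ∀ x, 0 ≤ p x) (hs : ∀ x, 0 < s x)
    (t : ℝ) (ht : 0 ≤ t) : ∃ Y,
    myJ (U * diagonal (fun i => (p i : ℂ)) * Uᴴ) (W * diagonal (fun i => (s i : ℂ)) * Wᴴ) t Y
      = ∑ x : n × n, Complex.normSq ((Wᴴ * U) x.1 x.2) * (p x.2 ^ 2 / (s x.1 + t * p x.2)) := by
  refine ⟨W * (Matrix.of fun j i => ((p i / (s j + t * p i) : ℝ) : ℂ) * (Wᴴ * U) j i) * Uᴴ, ?_⟩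
  rw [my_J_eq _ _ _ _ _ hU hW]
  refine Finset.sum_congr rfl fun x _ => ?_
  have hpos : s x.1 + t * p x.2 ≠ 0 := by
    have := hs x.1; have := mul_nonneg ht (hp x.2); positivity
  simp only [Matrix.of_apply]
  generalize (Wᴴ * U) x.1 x.2 = c
  generalize s x.1 + t * p x.2 = a at *
  generalize p x.2 = q at *
  simp only [Complex.normSq_apply, Complex.mul_re, Complex.mul_im, Complex.star_def, Complex.conj_re, Complex.conj_im, Complex.ofReal_re, Complex.ofReal_im]
  field_simp
  ring

lemma my_trace_one_kron {a m : Type*} [Fintype a] [Fintype m] [DecidableEq a]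
    (ρ : Matrix (a × m) (a × m) ℂ) (Z : Matrix m m ℂ) :
    (ρ * ((1 : Matrix a a ℂ) ⊗ₖ Z)).trace = (ptL ρ * Z).trace := by
  simp only [trace, diag, mul_apply, ptL, Matrix.of_apply, Fintype.sum_prod_type,
    kroneckerMap_apply, one_apply, ite_mul, one_mul, zero_mul, mul_ite, mul_zero, Finset.sum_mul]
  rw [Finset.sum_comm]
  refine Finset.sum_congr rfl fun i _ => ?_
  rw [Finset.sum_comm (s := (Finset.univ : Finset m))]
  refine Finset.sum_congr rfl fun k _ => ?_
  rw [Finset.sum_comm]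
  simp

lemma my_trace_kron_one {a m : Type*} [Fintype a] [Fintype m] [DecidableEq m]
    (ρ : Matrix (a × m) (a × m) ℂ) (Z : Matrix a a ℂ) :
    (ρ * (Z ⊗ₖ (1 : Matrix m m ℂ))).trace = (ptR ρ * Z).trace := by
  simp only [trace, diag, mul_apply, ptR, Matrix.of_apply, Fintype.sum_prod_type,
    kroneckerMap_apply, one_apply, mul_ite, mul_one, mul_zero, Finset.sum_mul]
  refine Finset.sum_congr rfl fun i _ => ?_
  rw [Finset.sum_comm]
  refine Finset.sum_congr rfl fun j _ => ?_
  simp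

lemma my_J_lift {a m : Type*} [Fintype a] [Fintype m] [DecidableEq a]
    (ρ σ : Matrix (a × m) (a × m) ℂ) (t : ℝ) (Y : Matrix m m ℂ) :
    myJ ρ σ t ((1 : Matrix a a ℂ) ⊗ₖ Y) = myJ (ptL ρ) (ptL σ) t Y := by
  simp only [myJ, conjTranspose_kronecker, conjTranspose_one, ← mul_kronecker_mul, Matrix.one_mul,
    my_trace_one_kron]

lemma my_w_sum {n : Type*} [Fintype n] [DecidableEq n] (U W : Matrix n n ℂ) (p f : n → ℝ) :
    ∑ x : n × n, Complex.normSq ((Wᴴ * U) x.1 x.2) * (p x.2 * f x.1) =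
      (U * diagonal (fun i => (p i : ℂ)) * Uᴴ * (W * diagonal (fun i => (f i : ℂ)) * Wᴴ)).trace.re
    := by
  have : (U * diagonal (fun i => (p i : ℂ)) * Uᴴ * (W * diagonal (fun i => (f i : ℂ)) * Wᴴ)).trace
      = ∑ x : n × n, ((Complex.normSq ((Wᴴ * U) x.1 x.2) * (p x.2 * f x.1) : ℝ) : ℂ) := by
    have e : U * diagonal (fun i => (p i : ℂ)) * Uᴴ * (W * diagonal (fun i => (f i : ℂ)) * Wᴴ)
      = (U * diagonal (fun i => (p i : ℂ)) * ((Wᴴ * U)ᴴ) * diagonal (fun i => (f i : ℂ))) * Wᴴ := by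
      simp only [conjTranspose_mul, conjTranspose_conjTranspose, Matrix.mul_assoc]
    rw [e, trace_mul_comm, ← Matrix.mul_assoc, ← Matrix.mul_assoc, ← Matrix.mul_assoc,
      Fintype.sum_prod_type]
    generalize Wᴴ * U = c
    simp only [trace, diag, mul_diagonal, Matrix.mul_apply (N := cᴴ), conjTranspose_apply, Finset.sum_mul]
    refine Finset.sum_congr rfl fun i _ => Finset.sum_congr rfl fun j _ => ?_
    push_cast
    rw [Complex.star_def, ← Complex.mul_conj]
    ring
  rw [this, Complex.re_sum]
  simp

lemma my_w_sum' {n : Type*} [Fintype n] [DecidableEq n] (U W : Matrix n n ℂ) (f : n → ℝ)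
    (hU : Uᴴ * U = 1) (hW : Wᴴ * W = 1) :
    ∑ x : n × n, Complex.normSq ((Wᴴ * U) x.1 x.2) * f x.2 = ∑ i, f i := by
  have h := my_w_sum U W f (fun _ => 1)
  simp only [mul_one] at h
  rw [h]
  have hW' := mul_eq_one_comm.1 hW
  have : (diagonal fun _ : n => ((1 : ℝ) : ℂ)) = 1 := by simp
  rw [this, Matrix.mul_one, hW', Matrix.mul_one, trace_mul_comm, ← Matrix.mul_assoc, hU,
    Matrix.one_mul]
  simp [trace]

lemma my_mono {a m : Type*} [Fintype a] [Fintype m] [DecidableEq a] [DecidableEq m]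
    (ρ σ U W : Matrix (a × m) (a × m) ℂ) (p s : a × m → ℝ) (U' W' : Matrix m m ℂ) (p' s' : m → ℝ)
    (hU : Uᴴ * U = 1) (hW : Wᴴ * W = 1) (hp : ∀ x, 0 ≤ p x) (hs : ∀ x, 0 < s x)
    (hU' : U'ᴴ * U' = 1) (hW' : W'ᴴ * W' = 1) (hp' : ∀ x, 0 ≤ p' x) (hs' : ∀ x, 0 < s' x)
    (hρ : ρ = U * diagonal (fun i => (p i : ℂ)) * Uᴴ)
    (hσ : σ = W * diagonal (fun i => (s i : ℂ)) * Wᴴ)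
    (hρ' : ptL ρ = U' * diagonal (fun i => (p' i : ℂ)) * U'ᴴ)
    (hσ' : ptL σ = W' * diagonal (fun i => (s' i : ℂ)) * W'ᴴ) :
    (ρ * (W * diagonal (fun i => (Real.log (s i) : ℂ)) * Wᴴ)).trace.re -
    (ptL ρ * (W' * diagonal (fun i => (Real.log (s' i) : ℂ)) * W'ᴴ)).trace.re ≤
    ∑ i, p i * Real.log (p i) - ∑ i, p' i * Real.log (p' i) := by
  have key := my_scalar (fun x : (a × m) × (a × m) => Complex.normSq ((Wᴴ * U) x.1 x.2))
    (fun x => p x.2) (fun x => s x.1)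
    (fun x : m × m => Complex.normSq ((W'ᴴ * U') x.1 x.2))
    (fun x => p' x.2) (fun x => s' x.1) (fun _ => hp _) (fun _ => hs _) (fun _ => hp' _)
    (fun _ => hs' _) ?_ ?_
  · rw [my_w_sum' U W (fun i => p i * Real.log (p i)) hU hW,
      my_w_sum' U' W' (fun i => p' i * Real.log (p' i)) hU' hW',
      my_w_sum U W p (fun j => Real.log (s j)), my_w_sum U' W' p' (fun j => Real.log (s' j)),
      ← hρ, ← hρ'] at key
    exact key
  · rw [my_w_sum' U W p hU hW, my_w_sum' U' W' p' hU' hW']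
    have h1 : ρ.trace = ((∑ i, p i : ℝ) : ℂ) := by
      rw [hρ, trace_mul_comm, ← Matrix.mul_assoc, hU, Matrix.one_mul]; simp [trace]
    have h2 : (ptL ρ).trace = ((∑ i, p' i : ℝ) : ℂ) := by
      rw [hρ', trace_mul_comm, ← Matrix.mul_assoc, hU', Matrix.one_mul]; simp [trace]
    have h3 := my_trace_one_kron ρ (1 : Matrix m m ℂ)
    rw [one_kronecker_one, Matrix.mul_one, Matrix.mul_one, h1, h2] at h3
    exact_mod_cast h3
  · intro t ht
    obtain ⟨Y, hY⟩ := my_J_attained U' W' p' s' hU' hW' hp' hs' t ht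
    rw [← hY, ← hρ', ← hσ', ← my_J_lift, hρ, hσ]
    exact my_J_le U W _ p s hU hW hp hs t ht

lemma my_vN_of_charpoly {n m : Type*} [Fintype n] [DecidableEq n] [Fintype m] [DecidableEq m]
    (A : Matrix n n ℂ) (B : Matrix m m ℂ) (hA : A.IsHermitian) (hB : B.IsHermitian)
    (h : A.charpoly = B.charpoly) : vN A = vN B := by
  have key : ∀ {k : Type _} [Fintype k] [DecidableEq k] (A : Matrix k k ℂ) (hA : A.IsHermitian),
      ∑ i, Real.negMulLog (hA.eigenvalues i) =
        (A.charpoly.roots.map (fun z : ℂ => Real.negMulLog z.re)).sum := by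
    intro k _ _ A hA
    rw [hA.roots_charpoly_eq_eigenvalues, Multiset.map_map]
    rfl
  have key' : ∀ {k : Type _} [Fintype k] [DecidableEq k] (A : Matrix k k ℂ) (hA : A.IsHermitian),
      ∑ i, Real.negMulLog (hA.eigenvalues i) =
        (A.charpoly.roots.map (fun z : ℂ => Real.negMulLog z.re)).sum := by
    intro k _ _ A hA
    rw [hA.roots_charpoly_eq_eigenvalues, Multiset.map_map]
    rfl
  rw [vN, vN, dif_pos hA, dif_pos hB, key A hA, key' B hB, h]

lemma my_vN_reindex {n m : Type*} [Fintype n] [DecidableEq n] [Fintype m] [DecidableEq m]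
    (A : Matrix n n ℂ) (hA : A.IsHermitian) (e : m ≃ n) : vN (A.submatrix e e) = vN A := by
  refine my_vN_of_charpoly _ _ (hA.submatrix e) hA ?_
  exact charpoly_reindex e.symm A

lemma my_vN_conj {n : Type*} [Fintype n] [DecidableEq n]
    (A U : Matrix n n ℂ) (hA : A.IsHermitian) (hU : Uᴴ * U = 1) : vN (U * A * Uᴴ) = vN A := by
  refine my_vN_of_charpoly _ _ (isHermitian_mul_mul_conjTranspose U hA) hA ?_
  rw [charpoly_mul_comm, ← Matrix.mul_assoc, hU, Matrix.one_mul]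

lemma my_spectral {n : Type*} [Fintype n] [DecidableEq n] (A : Matrix n n ℂ) (hA : A.PosSemidef) :
    ∃ (U : Matrix n n ℂ) (p : n → ℝ), Uᴴ * U = 1 ∧ (∀ i, 0 ≤ p i) ∧
      A = U * diagonal (fun i => (p i : ℂ)) * Uᴴ ∧ vN A = - ∑ i, p i * Real.log (p i) := by
  refine ⟨(hA.1.eigenvectorUnitary : Matrix n n ℂ), hA.1.eigenvalues, ?_, hA.eigenvalues_nonneg,
    ?_, ?_⟩
  · exact Unitary.coe_star_mul_self hA.1.eigenvectorUnitary
  · have := hA.1.spectral_theorem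
    rw [Unitary.conjStarAlgAut_apply] at this
    exact this
  · rw [vN, dif_pos hA.1]
    simp [Real.negMulLog]

lemma my_ptL_conj {a m : Type*} [Fintype a] [Fintype m] [DecidableEq a]
    (ρ : Matrix (a × m) (a × m) ℂ) (W : Matrix m m ℂ) :
    ptL (((1 : Matrix a a ℂ) ⊗ₖ W) * ρ * ((1 : Matrix a a ℂ) ⊗ₖ W)ᴴ) = W * ptL ρ * Wᴴ := by
  ext i j
  simp only [conjTranspose_kronecker, conjTranspose_one, ptL, Matrix.of_apply, Matrix.mul_apply,
    Fintype.sum_prod_type, kroneckerMap_apply, one_apply, ite_mul, one_mul, zero_mul, mul_ite,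
    mul_zero, Finset.sum_mul, Finset.mul_sum]
  simp only [Finset.sum_ite_irrel, Finset.sum_const_zero, Finset.sum_ite_eq, Finset.sum_ite_eq',
    Finset.mem_univ, if_true]
  rw [Finset.sum_comm]
  refine Finset.sum_congr rfl fun k _ => ?_
  rw [Finset.sum_comm]

lemma my_ptR_conj {a m : Type*} [Fintype a] [Fintype m] [DecidableEq a] [DecidableEq m]
    (ρ : Matrix (a × m) (a × m) ℂ) (W : Matrix m m ℂ) (hW : Wᴴ * W = 1) :
    ptR (((1 : Matrix a a ℂ) ⊗ₖ W) * ρ * ((1 : Matrix a a ℂ) ⊗ₖ W)ᴴ) = ptR ρ := by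
  ext i j
  have e : ∀ σ : Matrix (a × m) (a × m) ℂ, ptR σ i j =
      (Matrix.of fun x y => σ (i, x) (j, y)).trace := fun σ => rfl
  have e2 : (Matrix.of fun x y => (((1 : Matrix a a ℂ) ⊗ₖ W) * ρ * ((1 : Matrix a a ℂ) ⊗ₖ W)ᴴ)
      (i, x) (j, y)) = W * (Matrix.of fun x y => ρ (i, x) (j, y)) * Wᴴ := by
    ext x y
    simp only [conjTranspose_kronecker, conjTranspose_one, Matrix.of_apply, Matrix.mul_apply,
      Fintype.sum_prod_type, kroneckerMap_apply, one_apply, ite_mul, one_mul, zero_mul, mul_ite,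
      mul_zero]
    simp only [Finset.sum_ite_irrel, Finset.sum_const_zero, Finset.sum_ite_eq, Finset.sum_ite_eq',
      Finset.mem_univ, if_true]
  rw [e, e2, trace_mul_comm, ← Matrix.mul_assoc, hW, Matrix.one_mul, ← e]

lemma my_posSemidef_sum {ι n : Type*} [Fintype n] (s : Finset ι) (f : ι → Matrix n n ℂ)
    (h : ∀ i ∈ s, (f i).PosSemidef) : (∑ i ∈ s, f i).PosSemidef :=
  Matrix.posSemidef_sum s h

lemma my_psd_ptL {a m : Type*} [Fintype a] [Fintype m]
    (ρ : Matrix (a × m) (a × m) ℂ) (h : ρ.PosSemidef) : (ptL ρ).PosSemidef := by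
  have : ptL ρ = ∑ k, ρ.submatrix (fun i => (k, i)) (fun i => (k, i)) := by
    ext i j; simp [ptL, Matrix.sum_apply]
  rw [this]
  exact my_posSemidef_sum _ _ fun k _ => h.submatrix _

lemma my_psd_ptR {a m : Type*} [Fintype a] [Fintype m]
    (ρ : Matrix (a × m) (a × m) ℂ) (h : ρ.PosSemidef) : (ptR ρ).PosSemidef := by
  have : ptR ρ = ∑ k, ρ.submatrix (fun i => (i, k)) (fun i => (i, k)) := by
    ext i j; simp [ptR, Matrix.sum_apply]
  rw [this]
  exact my_posSemidef_sum _ _ fun k _ => h.submatrix _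

/-- Lift from `a × b` to `a × b × c`. -/
def myLift {a b : Type*} (c : Type*) [DecidableEq c] (X : Matrix (a × b) (a × b) ℂ) :
    Matrix (a × b × c) (a × b × c) ℂ :=
  (X ⊗ₖ (1 : Matrix c c ℂ)).submatrix (Equiv.prodAssoc a b c).symm (Equiv.prodAssoc a b c).symm

section
variable {a b c : Type*} [Fintype a] [Fintype b] [Fintype c]
    [DecidableEq a] [DecidableEq b] [DecidableEq c]

lemma myLift_mul (X Y : Matrix (a × b) (a × b) ℂ) :
    myLift c (X * Y) = myLift c X * myLift c Y := by
  rw [myLift, myLift, myLift, submatrix_mul_equiv, ← mul_kronecker_mul, Matrix.one_mul]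

lemma myLift_one : myLift c (1 : Matrix (a × b) (a × b) ℂ) = 1 := by
  rw [myLift, one_kronecker_one, submatrix_one_equiv]

lemma myLift_conj (X : Matrix (a × b) (a × b) ℂ) : myLift c Xᴴ = (myLift c X)ᴴ := by
  rw [myLift, myLift, conjTranspose_submatrix, conjTranspose_kronecker, conjTranspose_one]

lemma myLift_diag (d : a × b → ℂ) :
    myLift c (diagonal d) = diagonal (fun i : a × b × c => d (i.1, i.2.1)) := by
  ext ⟨i, j, k⟩ ⟨i', j', k'⟩
  simp only [myLift, submatrix_apply, kroneckerMap_apply, diagonal_apply, one_apply,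
    Equiv.prodAssoc_symm_apply, Prod.mk.injEq]
  split_ifs <;> simp_all

lemma my_trace_lift (ρ : Matrix (a × b × c) (a × b × c) ℂ) (X : Matrix (a × b) (a × b) ℂ) :
    (ρ * myLift c X).trace = (mAB ρ * X).trace := by
  have h := my_trace_kron_one (ρ.submatrix (Equiv.prodAssoc a b c) (Equiv.prodAssoc a b c)) X
  have e : ptR (ρ.submatrix (Equiv.prodAssoc a b c) (Equiv.prodAssoc a b c)) = mAB ρ := rfl
  rw [e] at h
  rw [← h, myLift]
  have e2 : ρ = (ρ.submatrix (Equiv.prodAssoc a b c) (Equiv.prodAssoc a b c)).submatrix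
    (Equiv.prodAssoc a b c).symm (Equiv.prodAssoc a b c).symm := by ext; simp
  conv_lhs => rw [e2]
  rw [submatrix_mul_equiv]
  exact Equiv.sum_comp (Equiv.prodAssoc a b c).symm (fun i => ((ρ.submatrix (Equiv.prodAssoc a b c)
    (Equiv.prodAssoc a b c)) * (X ⊗ₖ (1 : Matrix c c ℂ))) i i)

lemma my_ptL_lift (X : Matrix (a × b) (a × b) ℂ) :
    ptL (myLift c X) = ptL X ⊗ₖ (1 : Matrix c c ℂ) := by
  ext ⟨i, k⟩ ⟨j, l⟩
  simp only [ptL, myLift, Matrix.of_apply, submatrix_apply, kroneckerMap_apply,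
    Equiv.prodAssoc_symm_apply, Finset.sum_mul]

lemma my_diag_sum {n : Type*} [Fintype n] [DecidableEq n] (A U : Matrix n n ℂ) (p f : n → ℝ)
    (hU : Uᴴ * U = 1) (hA : A = U * diagonal (fun i => (p i : ℂ)) * Uᴴ) :
    (A * (U * diagonal (fun i => (f i : ℂ)) * Uᴴ)).trace.re = ∑ i, p i * f i := by
  have : A * (U * diagonal (fun i => (f i : ℂ)) * Uᴴ)
      = U * (diagonal (fun i => ((p i * f i : ℝ) : ℂ)) * Uᴴ) := by
    rw [hA]
    simp only [Matrix.mul_assoc]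
    rw [← Matrix.mul_assoc Uᴴ U, hU, Matrix.one_mul, ← Matrix.mul_assoc (diagonal _) (diagonal _),
      diagonal_mul_diagonal]
    simp
  rw [this, trace_mul_comm, Matrix.mul_assoc, hU, Matrix.mul_one, trace_diagonal, Complex.re_sum]
  simp

lemma my_shift {n : Type*} [Fintype n] [DecidableEq n] (A U : Matrix n n ℂ) (p : n → ℝ) (δ : ℝ)
    (hU : Uᴴ * U = 1) (hA : A = U * diagonal (fun i => (p i : ℂ)) * Uᴴ) :
    A + (δ : ℂ) • 1 = U * diagonal (fun i => ((p i + δ : ℝ) : ℂ)) * Uᴴ := by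
  have : diagonal (fun i => ((p i + δ : ℝ) : ℂ)) =
      diagonal (fun i => (p i : ℂ)) + (δ : ℂ) • (1 : Matrix n n ℂ) := by
    rw [smul_one_eq_diagonal, diagonal_add]; simp
  rw [this, Matrix.mul_add, Matrix.add_mul, ← hA, Matrix.mul_smul, Matrix.smul_mul, Matrix.mul_one,
    mul_eq_one_comm.1 hU]

lemma my_limit {n : Type*} [Fintype n] (p : n → ℝ) (hp : ∀ i, 0 ≤ p i) (d : ℝ) :
    Filter.Tendsto (fun δ : ℝ => ∑ i, p i * Real.log (p i + d * δ)) (nhdsWithin 0 (Set.Ioi 0))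
      (nhds (∑ i, p i * Real.log (p i))) := by
  refine tendsto_finsetSum _ fun i _ => ?_
  refine Filter.Tendsto.mono_left ?_ nhdsWithin_le_nhds
  rcases (hp i).eq_or_lt with h | h
  · simp [← h]
  · have h1 : Filter.Tendsto (fun δ : ℝ => p i + d * δ) (nhds 0) (nhds (p i)) := by
      have : Continuous (fun δ : ℝ => p i + d * δ) := by fun_prop
      simpa using this.tendsto 0
    exact ((Real.continuousAt_log h.ne').tendsto.comp h1).const_mul _

lemma my_ssa [Nonempty a] (ρ : Matrix (a × b × c) (a × b × c) ℂ) (h : ρ.PosSemidef) :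
    0 ≤ CMI ρ := by
  have hAB : (mAB ρ).PosSemidef :=
    my_psd_ptR (ρ.submatrix (Equiv.prodAssoc a b c) (Equiv.prodAssoc a b c)) (h.submatrix _)
  have hBC := my_psd_ptL ρ h
  have hB : (mB ρ).PosSemidef := by
    have : mB ρ = ptR (ptL ρ) := by
      ext i j
      simp only [mB, ptR, ptL, Matrix.of_apply]
      rw [Finset.sum_comm]
    rw [this]; exact my_psd_ptR _ hBC
  have eB : ptR (ptL ρ) = mB ρ := by
    ext i j
    simp only [mB, ptR, ptL, Matrix.of_apply]
    rw [Finset.sum_comm]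
  have eB2 : ptL (mAB ρ) = mB ρ := by
    ext i j
    simp only [mB, mAB, ptL, Matrix.of_apply]
  obtain ⟨U, p, hU, hp, eU, vU⟩ := my_spectral ρ h
  obtain ⟨U', p', hU', hp', eU', vU'⟩ := my_spectral _ hBC
  obtain ⟨S, s, hS, hs, eS, vS⟩ := my_spectral _ hAB
  obtain ⟨T, r, hT, hr, eT, vT⟩ := my_spectral _ hB
  have hcard : (0 : ℝ) < Fintype.card a := by exact_mod_cast Fintype.card_pos
  have hd : ∀ δ : ℝ, 0 < δ → ∑ i, s i * Real.log (s i + 1 * δ) -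
      ∑ i, r i * Real.log (r i + Fintype.card a * δ) ≤
      ∑ i, p i * Real.log (p i) - ∑ i, p' i * Real.log (p' i) := by
    intro δ hδ
    have key := my_mono ρ (myLift c (mAB ρ + (δ : ℂ) • 1)) U (myLift c S) p
      (fun i => s (i.1, i.2.1) + δ) U' (T ⊗ₖ (1 : Matrix c c ℂ)) p'
      (fun i => r i.1 + Fintype.card a * δ) hU
      (by rw [← myLift_conj, ← myLift_mul, hS, myLift_one]) hp
      (fun i => by have := hs (i.1, i.2.1); positivity) hU'
      (by rw [conjTranspose_kronecker, ← mul_kronecker_mul, hT, conjTranspose_one, Matrix.one_mul,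
            one_kronecker_one]) hp'
      (fun i => by have := hr i.1; positivity) eU
      (by rw [my_shift _ S s δ hS eS, myLift_mul, myLift_mul, myLift_diag, myLift_conj]) eU'
      (by
        have e1 : ptL (mAB ρ + (δ : ℂ) • 1) = mB ρ + ((Fintype.card a * δ : ℝ) : ℂ) • 1 := by
          rw [← eB2]
          ext i j
          simp [ptL, Finset.sum_add_distrib, one_apply]
        have e2 : diagonal (fun i : b × c => ((r i.1 + Fintype.card a * δ : ℝ) : ℂ)) =
          diagonal (fun i : b => ((r i + Fintype.card a * δ : ℝ) : ℂ)) ⊗ₖ (1 : Matrix c c ℂ) := by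
          rw [← diagonal_one, diagonal_kronecker_diagonal]
          simp
        rw [my_ptL_lift, e1, my_shift _ T r _ hT eT, e2, conjTranspose_kronecker,
          conjTranspose_one, ← mul_kronecker_mul, ← mul_kronecker_mul, Matrix.one_mul,
          Matrix.one_mul])
    have f1 : myLift c S * diagonal (fun i : a × b × c =>
          (Real.log (s (i.1, i.2.1) + δ) : ℂ)) * (myLift c S)ᴴ =
        myLift c (S * diagonal (fun i => (Real.log (s i + δ) : ℂ)) * Sᴴ) := by
      rw [myLift_mul, myLift_mul, myLift_diag, myLift_conj]
    have f2 : (T ⊗ₖ (1 : Matrix c c ℂ)) * diagonal (fun i : b × c =>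
          (Real.log (r i.1 + Fintype.card a * δ) : ℂ)) * (T ⊗ₖ (1 : Matrix c c ℂ))ᴴ =
        (T * diagonal (fun i => (Real.log (r i + Fintype.card a * δ) : ℂ)) * Tᴴ) ⊗ₖ 1 := by
      have e2 : diagonal (fun i : b × c => (Real.log (r i.1 + Fintype.card a * δ) : ℂ)) =
          diagonal (fun i : b => (Real.log (r i + Fintype.card a * δ) : ℂ)) ⊗ₖ
            (1 : Matrix c c ℂ) := by
          rw [← diagonal_one, diagonal_kronecker_diagonal]
          simp
      rw [e2, conjTranspose_kronecker, conjTranspose_one, ← mul_kronecker_mul, ← mul_kronecker_mul,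
        Matrix.one_mul, Matrix.one_mul]
    rw [f1, f2, my_trace_lift, my_trace_kron_one, eB,
      my_diag_sum (mAB ρ) S s (fun i => Real.log (s i + δ)) hS eS,
      my_diag_sum (mB ρ) T r (fun i => Real.log (r i + Fintype.card a * δ)) hT eT] at key
    simpa using key
  have hlim := le_of_tendsto ((my_limit s hs 1).sub (my_limit r hr (Fintype.card a)))
    (Filter.eventually_of_mem self_mem_nhdsWithin fun δ hδ => hd δ hδ)
  rw [CMI, vU, vU', vS, vT]
  linarith

end

lemma my_ssa4 {R Q E F : Type*}
    [Fintype R] [Fintype Q] [Fintype E] [Fintype F]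
    [DecidableEq R] [DecidableEq Q] [DecidableEq E] [DecidableEq F] [Nonempty R]
    (σ : Matrix (R × Q × E × F) (R × Q × E × F) ℂ) (hσ : σ.PosSemidef) : 0 ≤ IREQF σ := by
  let e0 : (Q × F) × E ≃ Q × E × F :=
    (Equiv.prodAssoc Q F E).trans ((Equiv.refl Q).prodCongr (Equiv.prodComm F E))
  let e : R × (Q × F) × E ≃ R × Q × E × F := (Equiv.refl R).prodCongr e0
  have h := my_ssa (σ.submatrix e e) (hσ.submatrix e)
  have e1 : mAB (σ.submatrix e e) = mRQF σ := rfl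
  have e2 : ptL (σ.submatrix e e) = (ptL σ).submatrix e0 e0 := rfl
  have e3 : mB (σ.submatrix e e) = mQF σ := rfl
  rw [CMI, e1, e2, e3, my_vN_reindex _ hσ.1, my_vN_reindex _ (my_psd_ptL σ hσ).1] at h
  exact h

/-- If `I(R;E'|Q'F)_σ ≤ ε`, then for every unitary `V` on `Q' ⊗ E'` the revival of
mutual information relative to `F` is bounded by `ε`. -/
theorem bounded_revival_of_small_cmi {R Q E F : Type*}
    [Fintype R] [Fintype Q] [Fintype E] [Fintype F]
    [DecidableEq R] [DecidableEq Q] [DecidableEq E] [DecidableEq F]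
    (σ : Matrix (R × Q × E × F) (R × Q × E × F) ℂ) (hσ : IsState σ)
    (ε : ℝ) (hε : 0 ≤ ε) (h : IREQF σ ≤ ε)
    (V : Matrix (Q × E) (Q × E) ℂ) (hV : IsUnitaryM V) :
    MI (mRQF (liftQE V * σ * (liftQE V)ᴴ)) - MI (mRQF σ) ≤ ε := by 
  have hne : Nonempty R := by
    by_contra hR
    rw [not_nonempty_iff] at hR
    have := hσ.2
    simp [trace] at this
  set W : Matrix (Q × E × F) (Q × E × F) ℂ := (V ⊗ₖ (1 : Matrix F F ℂ)).submatrix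
    (Equiv.prodAssoc Q E F).symm (Equiv.prodAssoc Q E F).symm with hWdef
  have hW : Wᴴ * W = 1 := by
    rw [hWdef, conjTranspose_submatrix, submatrix_mul_equiv, conjTranspose_kronecker,
      ← mul_kronecker_mul, hV.2, conjTranspose_one, Matrix.one_mul, one_kronecker_one,
      submatrix_one_equiv]
  have hL : (liftQE V : Matrix (R × Q × E × F) (R × Q × E × F) ℂ) = (1 : Matrix R R ℂ) ⊗ₖ W := rfl
  have hLu : ((1 : Matrix R R ℂ) ⊗ₖ W)ᴴ * ((1 : Matrix R R ℂ) ⊗ₖ W) = 1 := by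
    rw [conjTranspose_kronecker, ← mul_kronecker_mul, hW, conjTranspose_one, Matrix.one_mul,
      one_kronecker_one]
  rw [hL]
  set τ := ((1 : Matrix R R ℂ) ⊗ₖ W) * σ * ((1 : Matrix R R ℂ) ⊗ₖ W)ᴴ with hτ
  have hτp : τ.PosSemidef := hσ.1.mul_mul_conjTranspose_same _
  have h0 := my_ssa4 τ hτp
  have e1 : vN τ = vN σ := my_vN_conj _ _ hσ.1.1 hLu
  have e2 : vN (ptL τ) = vN (ptL σ) := by
    rw [hτ, my_ptL_conj, my_vN_conj _ _ (my_psd_ptL σ hσ.1).1 hW]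
  have e3 : ∀ ω : Matrix (R × Q × E × F) (R × Q × E × F) ℂ, ptR (mRQF ω) = ptR ω := by
    intro ω
    ext i j
    simp only [ptR, mRQF, Matrix.of_apply, Fintype.sum_prod_type]
    refine Finset.sum_congr rfl fun q _ => ?_
    rw [Finset.sum_comm]
  have e4 : ∀ ω : Matrix (R × Q × E × F) (R × Q × E × F) ℂ, ptL (mRQF ω) = mQF ω :=
    fun ω => rfl
  have e5 : ptR τ = ptR σ := my_ptR_conj σ W hW
  rw [MI, MI, e3, e3, e4, e4, e5]
  rw [IREQF] at h h0
  rw [e1, e2] at h0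
  linarith
end
end
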